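/- arXiv:1506.01921 — 2 statements merged into one kernel-verified Lean document; each statement's English description precedes it below -/
import Mathlib

section
/- Let μ be a finite positive Borel measure on 𝕋^d×𝕋^d, where 𝕋 = ℝ/2πℤ, let ν be the normalized Haar probability measure on 𝕋^d, and let M > 0. Assume that both marginals of μ are dominated by M·ν, i.e., μ(A×𝕋^d) ≤ M ν(A) and μ(𝕋^d×B) ≤ M ν(B) for all Borel sets A, B ⊆ 𝕋^d. Define r(ξ,η) = ∫ e^{i(ξ·p − η·q)} dμ(p,q) for ξ, η ∈ ℤ^d. Then for every finitely supported φ : ℤ^d → ℂ one has Σ_{ξ∈ℤ^d} |Σ_{η∈ℤ^d} r(ξ,η) φ(η)|² ≤ M² Σ_{η∈ℤ^d} |φ(η)|² and Σ_{ξ∈ℤ^d} |Σ_{η∈ℤ^d} r(0,η−ξ) φ(η)|² ≤ M² Σ_{η∈ℤ^d} |φ(η)|²; that is, the gain operator G with kernel r(ξ,η) and the loss operator L with kernel r(0,η−ξ) extend to bounded operators on ℓ²(ℤ^d) of norm at most M. -/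
open MeasureTheory Filter Complex

noncomputable section

/-- The lattice `ℤ^d`. -/
abbrev ZLat (d : ℕ) := Fin d → ℤ

/-- The `d`-torus `𝕋^d = (ℝ/2πℤ)^d`. -/
abbrev Torus (d : ℕ) := Fin d → AddCircle (2 * Real.pi)

/-- The character `p ↦ e^{i ξ·p}` of the `d`-torus. -/
def torusChar {d : ℕ} (ξ : ZLat d) (p : Torus d) : ℂ :=
  ∏ i, (AddCircle.toCircle (ξ i • p i) : ℂ)

instance : Fact (0 < 2 * Real.pi) := ⟨by positivity⟩

/-- The normalized Haar probability measure on the `d`-torus `𝕋^d`. -/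
def haarTorus (d : ℕ) : Measure (Torus d) :=
  Measure.pi (fun _ : Fin d => (ENNReal.ofReal (2 * Real.pi))⁻¹ • volume)

open scoped ComplexConjugate

lemma haarTorus_eq_pi_haarAddCircle (d : ℕ) :
    haarTorus d = Measure.pi (fun _ : Fin d => AddCircle.haarAddCircle) := by
  have h0 : ENNReal.ofReal (2 * Real.pi) ≠ 0 := by
    simp [Real.pi_pos]
  simp only [haarTorus, AddCircle.volume_eq_smul_haarAddCircle, smul_smul,
    ENNReal.inv_mul_cancel h0 ENNReal.ofReal_ne_top, one_smul]

instance (d : ℕ) : IsProbabilityMeasure (haarTorus d) := by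
  rw [haarTorus_eq_pi_haarAddCircle]
  infer_instance

@[fun_prop]
lemma continuous_torusChar {d : ℕ} (ξ : ZLat d) : Continuous (torusChar ξ) :=
  continuous_finsetProd _ fun i _ => (fourier (ξ i)).continuous.comp (continuous_apply i)

lemma torusChar_zero {d : ℕ} (p : Torus d) : torusChar 0 p = 1 := by
  simp [torusChar]

lemma torusChar_sub {d : ℕ} (ξ η : ZLat d) (p : Torus d) :
    torusChar (ξ - η) p = torusChar ξ p * conj (torusChar η p) := by
  simp only [torusChar, map_prod, ← Finset.prod_mul_distrib]
  refine Finset.prod_congr rfl fun i _ => ?_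
  simp only [← fourier_apply, Pi.sub_apply, sub_eq_add_neg, fourier_add, fourier_neg]

lemma integral_fourier_haarAddCircle {T : ℝ} [hT : Fact (0 < T)] (n : ℤ) :
    ∫ x : AddCircle T, fourier n x ∂AddCircle.haarAddCircle = if n = 0 then 1 else 0 := by
  split_ifs with h
  · simp [h]
  · exact integral_eq_zero_of_add_right_eq_neg (fourier_add_half_inv_index h hT.elim)

lemma integral_torusChar {d : ℕ} (ξ : ZLat d) :
    ∫ p, torusChar ξ p ∂haarTorus d = if ξ = 0 then 1 else 0 := by
  rw [haarTorus_eq_pi_haarAddCircle]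
  have h := integral_fintype_prod_eq_prod (𝕜 := ℂ)
    (fun i (x : AddCircle (2 * Real.pi)) => fourier (ξ i) x)
    (μ := fun _ : Fin d => AddCircle.haarAddCircle)
  simp only [integral_fourier_haarAddCircle] at h
  refine h.trans ?_
  simp [Finset.prod_ite_zero, funext_iff]

/-- A trigonometric polynomial on the torus. -/
def trigPoly {d : ℕ} (s : Finset (ZLat d)) (a : ZLat d → ℂ) (p : Torus d) : ℂ :=
  ∑ ξ ∈ s, a ξ * torusChar ξ p

@[fun_prop]
lemma continuous_trigPoly {d : ℕ} (s : Finset (ZLat d)) (a : ZLat d → ℂ) :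
    Continuous (trigPoly s a) := by
  unfold trigPoly
  fun_prop

lemma Continuous.integrable_of_compactSpace {X E : Type*} [TopologicalSpace X] [CompactSpace X]
    [MeasurableSpace X] [OpensMeasurableSpace X] [NormedAddCommGroup E]
    [SecondCountableTopologyEither X E] {μ : Measure X} [IsFiniteMeasure μ] {f : X → E}
    (hf : Continuous f) : Integrable f μ := by
  obtain ⟨C, hC⟩ := (isCompact_range hf).isBounded.exists_norm_le
  exact .of_bound hf.aestronglyMeasurable C (.of_forall fun x => hC _ ⟨x, rfl⟩)

/-- Parseval's identity for trigonometric polynomials. -/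
lemma integral_norm_trigPoly_sq {d : ℕ} (s : Finset (ZLat d)) (a : ZLat d → ℂ) :
    ∫ p, ‖trigPoly s a p‖ ^ 2 ∂haarTorus d = ∑ ξ ∈ s, ‖a ξ‖ ^ 2 := by
  rw [← Complex.ofReal_inj, ← integral_complex_ofReal]
  have h (p : Torus d) : ((‖trigPoly s a p‖ ^ 2 : ℝ) : ℂ) =
      ∑ ξ ∈ s, ∑ η ∈ s, a ξ * conj (a η) * torusChar (ξ - η) p := by
    push_cast
    rw [← Complex.mul_conj', trigPoly, map_sum, Finset.sum_mul_sum]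
    refine Finset.sum_congr rfl fun ξ _ => Finset.sum_congr rfl fun η _ => ?_
    rw [torusChar_sub, map_mul]
    ring
  simp only [h]
  rw [integral_finsetSum _ fun ξ _ => Continuous.integrable_of_compactSpace (by fun_prop)]
  push_cast
  refine Finset.sum_congr rfl fun ξ hξ => ?_
  rw [integral_finsetSum _ fun η _ => Continuous.integrable_of_compactSpace (by fun_prop)]
  simp [integral_const_mul, integral_torusChar, sub_eq_zero, hξ, Complex.mul_conj']

lemma integral_norm_trigPoly_sq_le {d : ℕ} {ν : Measure (Torus d)} {M : ℝ} (hM : 0 ≤ M)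
    (hν : ν ≤ ENNReal.ofReal M • haarTorus d) (s : Finset (ZLat d)) (a : ZLat d → ℂ) :
    ∫ p, ‖trigPoly s a p‖ ^ 2 ∂ν ≤ M * ∑ ξ ∈ s, ‖a ξ‖ ^ 2 := by
  have hint : Integrable (fun p => ‖trigPoly s a p‖ ^ 2) (haarTorus d) :=
    Continuous.integrable_of_compactSpace (by fun_prop)
  refine (integral_mono_measure hν (.of_forall fun p => by positivity)
    (hint.smul_measure ENNReal.ofReal_ne_top)).trans_eq ?_
  rw [integral_smul_measure, ENNReal.toReal_ofReal hM, integral_norm_trigPoly_sq, smul_eq_mul]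

/-- The Fourier transform of a measure on the product of two tori whose marginals are dominated by
`M` times Haar measure, viewed as a kernel, is bounded on `ℓ²` with norm at most `M`. -/
lemma sum_norm_fourier_kernel_sq_le {d : ℕ} {μ : Measure (Torus d × Torus d)} [IsFiniteMeasure μ]
    {M : ℝ} (hM : 0 < M) (hfst : μ.fst ≤ ENNReal.ofReal M • haarTorus d)
    (hsnd : μ.snd ≤ ENNReal.ofReal M • haarTorus d) {r : ZLat d → ZLat d → ℂ}
    (hr : ∀ ξ η, r ξ η = ∫ pq, torusChar ξ pq.1 * conj (torusChar η pq.2) ∂μ)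
    (s t : Finset (ZLat d)) (a : ZLat d → ℂ) :
    ∑ ξ ∈ s, ‖∑ η ∈ t, r ξ η * a η‖ ^ 2 ≤ M ^ 2 * ∑ η ∈ t, ‖a η‖ ^ 2 := by
  set g : ZLat d → ℂ := fun ξ => ∑ η ∈ t, r ξ η * a η with hg
  set F := trigPoly s (fun ξ => conj (g ξ)) with hF
  set H := trigPoly t (fun η => conj (a η)) with hH
  have hFc : Continuous F := continuous_trigPoly _ _
  have hHc : Continuous H := continuous_trigPoly _ _
  have key : ((∑ ξ ∈ s, ‖g ξ‖ ^ 2 : ℝ) : ℂ) = ∫ pq, F pq.1 * conj (H pq.2) ∂μ := by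
    have h (pq : Torus d × Torus d) : F pq.1 * conj (H pq.2) = ∑ ξ ∈ s, ∑ η ∈ t,
        (conj (g ξ) * a η) * (torusChar ξ pq.1 * conj (torusChar η pq.2)) := by
      rw [hF, hH, trigPoly, trigPoly, map_sum, Finset.sum_mul_sum]
      refine Finset.sum_congr rfl fun ξ _ => Finset.sum_congr rfl fun η _ => ?_
      rw [map_mul, Complex.conj_conj]
      ring
    simp only [h]
    rw [integral_finsetSum _ fun ξ _ => Continuous.integrable_of_compactSpace (by fun_prop)]
    push_cast
    refine Finset.sum_congr rfl fun ξ _ => ?_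
    rw [integral_finsetSum _ fun η _ => Continuous.integrable_of_compactSpace (by fun_prop)]
    simp only [integral_const_mul, ← hr]
    rw [← Complex.conj_mul']
    conv_lhs => rw [hg]
    rw [Finset.mul_sum]
    exact Finset.sum_congr rfl fun η _ => by ring
  have hF2 : ∫ pq, ‖F pq.1‖ ^ 2 ∂μ ≤ M * ∑ ξ ∈ s, ‖g ξ‖ ^ 2 := by
    have h := integral_norm_trigPoly_sq_le hM.le hfst s (fun ξ => conj (g ξ))
    rw [Measure.fst, integral_map (by fun_prop)
      (Continuous.aestronglyMeasurable (by fun_prop))] at h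
    simpa only [RCLike.norm_conj] using h
  have hH2 : ∫ pq, ‖H pq.2‖ ^ 2 ∂μ ≤ M * ∑ η ∈ t, ‖a η‖ ^ 2 := by
    have h := integral_norm_trigPoly_sq_le hM.le hsnd t (fun η => conj (a η))
    rw [Measure.snd, integral_map (by fun_prop)
      (Continuous.aestronglyMeasurable (by fun_prop))] at h
    simpa only [RCLike.norm_conj] using h
  have young : M * ∑ ξ ∈ s, ‖g ξ‖ ^ 2 ≤
      (∫ pq, ‖F pq.1‖ ^ 2 ∂μ) / 2 + M ^ 2 * (∫ pq, ‖H pq.2‖ ^ 2 ∂μ) / 2 := by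
    have hle : ∑ ξ ∈ s, ‖g ξ‖ ^ 2 ≤ ∫ pq, ‖F pq.1 * conj (H pq.2)‖ ∂μ := by
      refine le_trans ?_ (norm_integral_le_integral_norm _)
      rw [← key, Complex.norm_real]
      exact le_abs_self _
    calc M * ∑ ξ ∈ s, ‖g ξ‖ ^ 2 ≤ M * ∫ pq, ‖F pq.1 * conj (H pq.2)‖ ∂μ := by gcongr
      _ = ∫ pq, M * ‖F pq.1 * conj (H pq.2)‖ ∂μ := (integral_const_mul _ _).symm
      _ ≤ ∫ pq, ‖F pq.1‖ ^ 2 / 2 + M ^ 2 * ‖H pq.2‖ ^ 2 / 2 ∂μ := by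
        refine integral_mono (Continuous.integrable_of_compactSpace (by fun_prop))
          (Continuous.integrable_of_compactSpace (by fun_prop)) fun pq => ?_
        simp only [norm_mul, RCLike.norm_conj]
        nlinarith [sq_nonneg (‖F pq.1‖ - M * ‖H pq.2‖)]
      _ = _ := by
        rw [integral_add (Continuous.integrable_of_compactSpace (by fun_prop))
          (Continuous.integrable_of_compactSpace (by fun_prop)), integral_div, integral_div,
          integral_const_mul]
  have hH3 := mul_le_mul_of_nonneg_left hH2 (sq_nonneg M)
  refine le_of_mul_le_mul_left ?_ hM
  linarith

/-- **Fröhlich–Schenker, Lemma 1.**  If both marginals of the jump-rate measure `μ`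
are dominated by `M` times normalized Haar measure, then the gain operator with kernel
`r(ξ,η)` and the loss operator with kernel `r(0,η−ξ)` are bounded on `ℓ²(ℤ^d)` with norm
at most `M`. -/
theorem gain_and_loss_operators_bounded
    (d : ℕ)
    (μ : Measure (Torus d × Torus d)) [IsFiniteMeasure μ]
    (M : ℝ) (hM : 0 < M)
    -- both marginals of `μ` are dominated by `M` times normalized Haar measure
    (hfst : ∀ A : Set (Torus d), MeasurableSet A →
      μ (A ×ˢ (Set.univ : Set (Torus d))) ≤ ENNReal.ofReal M * haarTorus d A)
    (hsnd : ∀ B : Set (Torus d), MeasurableSet B →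
      μ ((Set.univ : Set (Torus d)) ×ˢ B) ≤ ENNReal.ofReal M * haarTorus d B)
    -- the gain kernel: the Fourier transform of `μ`
    (r : ZLat d → ZLat d → ℂ)
    (hr : ∀ ξ η : ZLat d,
      r ξ η = ∫ pq, torusChar ξ pq.1 * (starRingEnd ℂ) (torusChar η pq.2) ∂μ) :
    ∀ φ : ZLat d →₀ ℂ,
      -- the gain operator is bounded with norm at most `M` ...
      (Summable (fun ξ : ZLat d => ‖∑ η ∈ φ.support, r ξ η * φ η‖ ^ 2) ∧
        ∑' ξ : ZLat d, ‖∑ η ∈ φ.support, r ξ η * φ η‖ ^ 2 ≤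
          M ^ 2 * ∑ η ∈ φ.support, ‖φ η‖ ^ 2) ∧
      -- ... and so is the loss operator
      (Summable (fun ξ : ZLat d => ‖∑ η ∈ φ.support, r 0 (η - ξ) * φ η‖ ^ 2) ∧
        ∑' ξ : ZLat d, ‖∑ η ∈ φ.support, r 0 (η - ξ) * φ η‖ ^ 2 ≤
          M ^ 2 * ∑ η ∈ φ.support, ‖φ η‖ ^ 2) := by
  have hfst' : μ.fst ≤ ENNReal.ofReal M • haarTorus d := Measure.le_iff.2 fun A hA => by
    simpa [Measure.fst_apply hA, Set.prod_univ] using hfst A hA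
  have hsnd' : μ.snd ≤ ENNReal.ofReal M • haarTorus d := Measure.le_iff.2 fun B hB => by
    simpa [Measure.snd_apply hB, Set.univ_prod] using hsnd B hB
  intro φ
  have gain := sum_norm_fourier_kernel_sq_le hM hfst' hsnd' hr
  have loss := sum_norm_fourier_kernel_sq_le (μ := μ.snd.map fun q => (q, q))
    (r := fun ξ η => r 0 (η - ξ)) hM
    (by rwa [Measure.fst, Measure.map_map (by fun_prop) (by fun_prop), Function.comp_def,
      Measure.map_id'])
    (by rwa [Measure.snd, Measure.map_map (by fun_prop) (by fun_prop), Function.comp_def,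
      Measure.map_id'])
    (fun ξ η => by
      rw [hr, integral_map (by fun_prop) (Continuous.aestronglyMeasurable (by fun_prop)),
        Measure.snd, integral_map (by fun_prop) (Continuous.aestronglyMeasurable (by fun_prop))]
      simp only [torusChar_zero, torusChar_sub, map_mul, Complex.conj_conj, one_mul, mul_comm])
  have pos (k : ZLat d → ZLat d → ℂ) :
      0 ≤ fun ξ : ZLat d => ‖∑ η ∈ φ.support, k ξ η * φ η‖ ^ 2 := fun ξ => by positivity
  exact ⟨⟨summable_of_sum_le (pos _) fun s => gain s _ φ,
      Real.tsum_le_of_sum_le (pos _) fun s => gain s _ φ⟩,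
    ⟨summable_of_sum_le (pos fun ξ η => r 0 (η - ξ)) fun s => loss s _ φ,
      Real.tsum_le_of_sum_le (pos fun ξ η => r 0 (η - ξ)) fun s => loss s _ φ⟩⟩

end
end

section
/- Let Ω = ℝ^{ℤ^d} with shifts τ_a ω(x) = ω(x−a) for a ∈ ℤ^d, and let r : ℤ^d×ℤ^d → ℂ satisfy r(ξ,η) = 0 unless ξ+η ∈ 2ℤ^d. Let Ψ : ℤ^d×ℤ^d×Ω → ℂ vanish for (X,ξ) outside some finite set and vanish unless X+ξ ∈ 2ℤ^d. Define the generalized Fourier transform FΨ(ξ,ω,k) = Σ_{a∈ℤ^d} e^{−i k·a} Ψ(ξ+2a, ξ, τ_a ω) for k ∈ ℝ^d, and the operators (TΨ)(X,ξ,ω) = Σ_{|e|=1}[Ψ(X+e,ξ+e,ω) − Ψ(X+e,ξ−e,ω)], (VΨ)(X,ξ,ω) = (ω((X+ξ)/2) − ω((X−ξ)/2)) Ψ(X,ξ,ω) (read as 0 when X+ξ ∉ 2ℤ^d), and (ℒΨ)(X,ξ,ω) = Σ_{η}[r(ξ,η) − r(0,η−ξ)] Ψ(X,η,ω). Then for all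 ξ ∈ ℤ^d, ω ∈ Ω, k ∈ ℝ^d: (1) F(TΨ)(ξ,ω,k) = Σ_{|e|=1}[FΨ(ξ+e,ω,k) − e^{−i k·e} FΨ(ξ+e, τ_e ω, k)]; (2) F(VΨ)(ξ,ω,k) = (ω(ξ) − ω(0)) FΨ(ξ,ω,k); (3) F(ℒΨ)(ξ,ω,k) = Σ_{η : η−ξ ∈ 2ℤ^d} e^{i k·(ξ−η)/2} [r(ξ,η) − r(0,η−ξ)] FΨ(η, τ_{(η−ξ)/2} ω, k). -/
open Complex

noncomputable section

/-- The `i`-th standard unit lattice vector. -/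
def unitVec {d : ℕ} (i : Fin d) : ZLat d := Pi.single i 1

/-- `x ∈ 2ℤ^d`, i.e. all coordinates of `x` are even. -/
def EvenVec {d : ℕ} (x : ZLat d) : Prop := ∀ i, x i % 2 = 0

instance {d : ℕ} : DecidablePred (EvenVec (d := d)) := fun _ => Fintype.decidableForallFintype

/-- Coordinatewise division by `2`. -/
def halfVec {d : ℕ} (x : ZLat d) : ZLat d := fun i => x i / 2

/-- The shift of a disorder configuration: `(τ_a ω)(x) = ω(x − a)`. -/
def shift {d : ℕ} (a : ZLat d) (ω : ZLat d → ℝ) : ZLat d → ℝ := fun x => ω (x - a)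

/-- The generalized Fourier transform
`FΨ(ξ,ω,k) = Σ_a e^{−i k·a} Ψ(ξ + 2a, ξ, τ_a ω)`. -/
def genFourier {d : ℕ} (Ψ : ZLat d → ZLat d → (ZLat d → ℝ) → ℂ)
    (ξ : ZLat d) (ω : ZLat d → ℝ) (k : Fin d → ℝ) : ℂ :=
  ∑' a : ZLat d,
    Complex.exp (-Complex.I * ∑ i, (k i : ℂ) * (a i : ℂ)) * Ψ (ξ + 2 • a) ξ (shift a ω)

section FiberDecomposition

variable {d : ℕ} {Ψ : ZLat d → ZLat d → (ZLat d → ℝ) → ℂ}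

lemma shift_shift (a b : ZLat d) (ω : ZLat d → ℝ) : shift a (shift b ω) = shift (a + b) ω := by
  funext x
  simp only [shift, sub_sub]

@[simp] lemma shift_zero (ω : ZLat d → ℝ) : shift 0 ω = ω := by
  funext x
  simp [shift]

lemma halfVec_two_nsmul (b : ZLat d) : halfVec (2 • b) = b := by
  funext i
  simp [halfVec]

lemma evenVec_two_nsmul (b : ZLat d) : EvenVec (2 • b) := fun i => by simp

lemma EvenVec.exists_eq_two_nsmul {x : ZLat d} (hx : EvenVec x) : ∃ b, x = 2 • b :=
  ⟨halfVec x, funext fun i => by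
    have := hx i
    simp only [halfVec, Pi.smul_apply, nsmul_eq_mul, Nat.cast_ofNat]
    omega⟩

lemma exp_phase_add (k : Fin d → ℝ) (a b : ZLat d) :
    exp (-I * ∑ i, (k i : ℂ) * ((a + b) i : ℂ)) =
      exp (-I * ∑ i, (k i : ℂ) * (a i : ℂ)) * exp (-I * ∑ i, (k i : ℂ) * (b i : ℂ)) := by
  rw [← exp_add, ← mul_add, ← Finset.sum_add_distrib]
  simp [mul_add]

lemma sum_mul_unitVec (k : Fin d → ℝ) (j : Fin d) :
    ∑ i, (k i : ℂ) * (unitVec j i : ℂ) = k j := by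
  simp [unitVec, Pi.single_apply]

lemma add_two_nsmul_injective (ζ : ZLat d) : Function.Injective fun a : ZLat d => ζ + 2 • a :=
  fun a b h => by
    rw [← halfVec_two_nsmul a, ← halfVec_two_nsmul b, add_left_cancel h]

/-- A family in `(a, η)` vanishing unless `(ξ + 2a, η)` lies in a finite set has finite support. -/
lemma finite_support_of_finset {s : Finset (ZLat d × ZLat d)} (ξ : ZLat d)
    {f : ZLat d × ZLat d → ℂ} (hf : ∀ p, (ξ + 2 • p.1, p.2) ∉ s → f p = 0) :
    f.support.Finite := by
  have hinj : Function.Injective fun p : ZLat d × ZLat d => (ξ + 2 • p.1, p.2) :=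
    (add_two_nsmul_injective ξ).prodMap Function.injective_id
  refine (s.finite_toSet.preimage hinj.injOn).subset fun p hp => ?_
  by_contra h
  exact hp (hf p h)

/-- Recentring the Fourier sum by `b` produces a phase and a shift of the disorder. -/
lemma hasSum_genFourier_shift
    (hΨ : ∃ s : Finset (ZLat d × ZLat d),
      ∀ (X ξ : ZLat d) (ω : ZLat d → ℝ), (X, ξ) ∉ s → Ψ X ξ ω = 0)
    (ξ η b : ZLat d) (hη : η = ξ + 2 • b) (ω : ZLat d → ℝ) (k : Fin d → ℝ) :
    HasSum (fun a : ZLat d =>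
        exp (-I * ∑ i, (k i : ℂ) * (a i : ℂ)) * Ψ (ξ + 2 • a) η (shift a ω))
      (exp (-I * ∑ i, (k i : ℂ) * (b i : ℂ)) * genFourier Ψ η (shift b ω) k) := by
  obtain ⟨s, hs⟩ := hΨ
  have hfin : (Function.support fun c : ZLat d =>
      exp (-I * ∑ i, (k i : ℂ) * (c i : ℂ)) *
        Ψ (η + 2 • c) η (shift c (shift b ω))).Finite := by
    have hinj : Function.Injective fun c : ZLat d => (η + 2 • c, η) :=
      fun a c h => add_two_nsmul_injective η (congrArg Prod.fst h)
    refine (s.finite_toSet.preimage hinj.injOn).subset fun c hc => ?_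
    by_contra h
    exact hc (by simp only [hs _ _ _ h, mul_zero])
  have h := (summable_of_hasFiniteSupport (L := .unconditional _) hfin).hasSum.mul_left
    (exp (-I * ∑ i, (k i : ℂ) * (b i : ℂ)))
  rw [← (Equiv.addRight b).hasSum_iff]
  refine h.congr_fun fun c => ?_
  have hX : ξ + 2 • (c + b) = η + 2 • c := by rw [hη, nsmul_add]; abel
  simp only [Function.comp_apply, Equiv.coe_addRight, hX, exp_phase_add, shift_shift]
  ring

end FiberDecomposition

/-- **Fröhlich–Schenker, Lemma 2 (fiber decomposition).**  The generalized Fourier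
transform over the center-of-mass variable intertwines the hopping, potential and
Lindblad parts of the generator with the stated fiber operators. -/
theorem fiber_decomposition_of_generator
    (d : ℕ)
    -- the gain kernel, vanishing unless `ξ + η ∈ 2ℤ^d`
    (r : ZLat d → ZLat d → ℂ)
    (hr_parity : ∀ ξ η : ZLat d, ¬ EvenVec (ξ + η) → r ξ η = 0)
    -- `Ψ`, supported on finitely many `(X, ξ)` and vanishing unless `X + ξ ∈ 2ℤ^d`
    (Ψ : ZLat d → ZLat d → (ZLat d → ℝ) → ℂ)
    (hΨsupp : ∃ s : Finset (ZLat d × ZLat d),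
      ∀ (X ξ : ZLat d) (ω : ZLat d → ℝ), (X, ξ) ∉ s → Ψ X ξ ω = 0)
    (hΨparity : ∀ (X ξ : ZLat d) (ω : ZLat d → ℝ), ¬ EvenVec (X + ξ) → Ψ X ξ ω = 0) :
    ∀ (ξ : ZLat d) (ω : ZLat d → ℝ) (k : Fin d → ℝ),
      -- (1) the hopping term
      genFourier (fun X ξ' ω' => ∑ i : Fin d,
          ((Ψ (X + unitVec i) (ξ' + unitVec i) ω' - Ψ (X + unitVec i) (ξ' - unitVec i) ω')
            + (Ψ (X - unitVec i) (ξ' - unitVec i) ω'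
                - Ψ (X - unitVec i) (ξ' + unitVec i) ω'))) ξ ω k =
        ∑ i : Fin d,
          ((genFourier Ψ (ξ + unitVec i) ω k
              - Complex.exp (-Complex.I * (k i : ℂ)) *
                  genFourier Ψ (ξ + unitVec i) (shift (unitVec i) ω) k)
            + (genFourier Ψ (ξ - unitVec i) ω k
              - Complex.exp (Complex.I * (k i : ℂ)) *
                  genFourier Ψ (ξ - unitVec i) (shift (-unitVec i) ω) k)) ∧
      -- (2) the potential term
      genFourier (fun X ξ' ω' =>
          (if EvenVec (X + ξ') then
            ((ω' (halfVec (X + ξ')) - ω' (halfVec (X - ξ')) : ℝ) : ℂ) else 0)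
            * Ψ X ξ' ω') ξ ω k =
        ((ω ξ - ω 0 : ℝ) : ℂ) * genFourier Ψ ξ ω k ∧
      -- (3) the Lindblad term
      genFourier (fun X ξ' ω' =>
          ∑' η : ZLat d, (r ξ' η - r 0 (η - ξ')) * Ψ X η ω') ξ ω k =
        ∑' η : ZLat d,
          if EvenVec (η - ξ) then
            Complex.exp (Complex.I * ∑ i, (k i : ℂ) * ((halfVec (ξ - η)) i : ℂ))
              * (r ξ η - r 0 (η - ξ))
              * genFourier Ψ η (shift (halfVec (η - ξ)) ω) k
          else 0 := by
  intro ξ ω k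
  refine ⟨?_, ?_, ?_⟩
  · have hsum := hasSum_sum (s := Finset.univ) fun (i : Fin d) _ =>
      ((hasSum_genFourier_shift hΨsupp (ξ + unitVec i) (ξ + unitVec i) 0 (by simp) ω k).sub
        (hasSum_genFourier_shift hΨsupp (ξ + unitVec i) (ξ - unitVec i) (-unitVec i)
          (by rw [two_nsmul]; abel) ω k)).add
      ((hasSum_genFourier_shift hΨsupp (ξ - unitVec i) (ξ - unitVec i) 0 (by simp) ω k).sub
        (hasSum_genFourier_shift hΨsupp (ξ - unitVec i) (ξ + unitVec i) (unitVec i)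
          (by rw [two_nsmul]; abel) ω k))
    have hneg : ∀ i : Fin d, ∑ j, (k j : ℂ) * ((-unitVec i : ZLat d) j : ℂ) = -(k i : ℂ) :=
      fun i => by simp [← sum_mul_unitVec k i]
    simp only [hneg, sum_mul_unitVec, shift_zero, Pi.zero_apply, Int.cast_zero, mul_zero,
      Finset.sum_const_zero, exp_zero, one_mul, neg_mul_neg] at hsum
    rw [genFourier]
    refine Eq.trans (tsum_congr fun a => ?_) (hsum.tsum_eq.trans ?_)
    · rw [Finset.mul_sum]
      refine Finset.sum_congr rfl fun i _ => ?_
      rw [add_right_comm ξ (unitVec i), sub_add_eq_add_sub ξ (unitVec i)]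
      ring
    · exact Finset.sum_congr rfl fun i _ => by ring
  · rw [genFourier, genFourier, ← tsum_mul_left]
    refine tsum_congr fun a => ?_
    have h1 : ξ + 2 • a + ξ = 2 • (ξ + a) := by rw [nsmul_add, two_nsmul ξ]; abel
    have h2 : ξ + 2 • a - ξ = 2 • a := by abel
    rw [h1, h2, if_pos (evenVec_two_nsmul _), halfVec_two_nsmul, halfVec_two_nsmul]
    simp only [shift, add_sub_cancel_right, sub_self]
    ring
  · obtain ⟨s, hs⟩ := hΨsupp
    have hsummable := summable_of_hasFiniteSupport (L := .unconditional _) <| finite_support_of_finset (s := s) ξ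
      (f := Function.uncurry fun a η : ZLat d =>
        exp (-I * ∑ i, (k i : ℂ) * (a i : ℂ)) *
          ((r ξ η - r 0 (η - ξ)) * Ψ (ξ + 2 • a) η (shift a ω)))
      fun p hp => by simp only [Function.uncurry, hs _ _ _ hp, mul_zero]
    rw [genFourier]
    simp only [← tsum_mul_left]
    rw [← hsummable.tsum_comm]
    refine tsum_congr fun η => ?_
    split_ifs with hη
    · obtain ⟨b, hb⟩ := hη.exists_eq_two_nsmul
      have hneg : ξ - η = 2 • (-b) := by rw [smul_neg, ← hb, neg_sub]
      have hsum := (hasSum_genFourier_shift ⟨s, hs⟩ ξ η b (by rw [← hb]; abel) ω k).mul_left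
        (r ξ η - r 0 (η - ξ))
      rw [hneg, halfVec_two_nsmul, hb, halfVec_two_nsmul, ← hb]
      refine Eq.trans (tsum_congr fun a => by ring) (hsum.tsum_eq.trans ?_)
      simp only [Pi.neg_apply, Int.cast_neg, mul_neg, Finset.sum_neg_distrib, neg_mul]
      ring
    · refine (tsum_congr fun a => ?_).trans tsum_zero
      have hodd : ¬ EvenVec (ξ + 2 • a + η) := fun h => hη fun i => by
        have := h i
        simp only [two_nsmul, Pi.add_apply, Pi.sub_apply] at this ⊢
        omega
      rw [hΨparity _ _ _ hodd, mul_zero, mul_zero]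

end
end
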